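/- arXiv:2109.12646 — 2 statements merged into one kernel-verified Lean document; each statement's English description precedes it below -/
import Mathlib

section
/- Let a ∈ ℂ with a ∉ {-1, 0, 2, 1/2}, and set d = 1 + 2a, g = 3a - 1, f = 1 + a. Define A, B, D as in the block construction (A = [[a, a-2, a-2], [-2a+1, d, -2a+1], [f, f, g]], B = [[a-2, -a+2, -a+2], [2a-1, -2a+1, 2a-1], [-f, -f, f]], D = [[-a+3, 3a-3, -a-1], [-a+2, 3a-2, -3a], [3, 2a-1, -2a-1]]), and let C be the unique solution of A²B - BCB - ABD + BD² = 0. Then det([[A,B],[C,D]]) = -64a⁶. -/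
open Matrix

/-- A block determinant whose upper right block is invertible. -/
lemma det_fromBlocks_of_isUnit_upper_right {n R : Type*} [Fintype n] [DecidableEq n] [CommRing R]
    (A B C D : Matrix n n R) (hB : IsUnit B.det) :
    (fromBlocks A B C D).det = B.det * (D * B⁻¹ * A - C).det := by
  have hN : (fromBlocks (1 : Matrix n n R) (-1) (1 - B⁻¹ * A) (B⁻¹ * A)).det = 1 := by
    simp [det_fromBlocks_one₁₁]
  have hBA : B * (B⁻¹ * A) = A := mul_nonsing_inv_cancel_left B A hB
  have hM : fromBlocks A B C D * fromBlocks 1 (-1) (1 - B⁻¹ * A) (B⁻¹ * A) =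
      fromBlocks B 0 (C + D * (1 - B⁻¹ * A)) (D * B⁻¹ * A - C) := by
    rw [fromBlocks_multiply, mul_sub, hBA]
    congr 1 <;> noncomm_ring
  rw [← mul_one (fromBlocks A B C D).det, ← hN, ← det_mul, hM, det_fromBlocks_zero₁₂]

/-- The block determinant when the lower left block solves
`A ^ 2 * B - B * C * B - A * B * D + B * D ^ 2 = 0`. -/
lemma det_fromBlocks_mul_det_sq {n R : Type*} [Fintype n] [DecidableEq n] [CommRing R]
    (A B D : Matrix n n R) (hB : IsUnit B.det) :
    (fromBlocks A B (B⁻¹ * (A ^ 2 * B - A * B * D + B * D ^ 2) * B⁻¹) D).det * B.det ^ 2 =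
      (-1) ^ Fintype.card n * (A * B - B * D).det ^ 2 := by
  have h₁ : B * B⁻¹ = 1 := mul_nonsing_inv B hB
  have h₂ : B⁻¹ * B = 1 := nonsing_inv_mul B hB
  have hE : (A - B * D * B⁻¹) * B = A * B - B * D := by
    rw [sub_mul, mul_assoc (B * D), h₂, mul_one]
  have key : B * (D * B⁻¹ * A - B⁻¹ * (A ^ 2 * B - A * B * D + B * D ^ 2) * B⁻¹) =
      -(A - B * D * B⁻¹) ^ 2 := by
    have hC : B * (B⁻¹ * (A ^ 2 * B - A * B * D + B * D ^ 2) * B⁻¹) =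
        A ^ 2 - A * (B * D * B⁻¹) + B * D * D * B⁻¹ := by
      rw [← mul_assoc, ← mul_assoc, h₁, one_mul, add_mul, sub_mul, mul_assoc (A ^ 2), h₁]
      noncomm_ring
    have hE2 : B * D * B⁻¹ * (B * D * B⁻¹) = B * D * D * B⁻¹ := by
      calc _ = B * D * (B⁻¹ * B) * D * B⁻¹ := by noncomm_ring
        _ = _ := by rw [h₂, mul_one]
    rw [mul_sub, hC, ← hE2]
    noncomm_ring
  rw [det_fromBlocks_of_isUnit_upper_right _ _ _ _ hB, ← det_mul, key, det_neg, det_pow, ← hE,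
    det_mul]
  ring

theorem stmt_8 (a : ℂ) (ha : a ≠ -1 ∧ a ≠ 0 ∧ a ≠ 2 ∧ a ≠ 1 / 2)
    (d g f : ℂ) (hd : d = 1 + 2 * a) (hg : g = 3 * a - 1) (hf : f = 1 + a)
    (A B D C : Matrix (Fin 3) (Fin 3) ℂ)
    (hA : A = !![a, a - 2, a - 2; -2 * a + 1, d, -2 * a + 1; f, f, g])
    (hB : B = !![a - 2, -a + 2, -a + 2; 2 * a - 1, -2 * a + 1, 2 * a - 1; -f, -f, f])
    (hD : D = !![-a + 3, 3 * a - 3, -a - 1; -a + 2, 3 * a - 2, -3 * a; 3, 2 * a - 1, -2 * a - 1])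
    (hC : C = B⁻¹ * (A ^ 2 * B - A * B * D + B * D ^ 2) * B⁻¹) :
    (fromBlocks A B C D).det = -64 * a ^ 6 := by
  obtain ⟨h₁, -, h₂, h₃⟩ := ha
  have hdetB : B.det = 4 * (a - 2) * (2 * a - 1) * (1 + a) := by
    rw [hB, det_fin_three, hf]
    simp
    ring
  have hne : B.det ≠ 0 := by
    rw [hdetB]
    have : 2 * a - 1 ≠ 0 := fun h => h₃ (by linear_combination h / 2)
    have : 1 + a ≠ 0 := fun h => h₁ (by linear_combination h)
    have : a - 2 ≠ 0 := sub_ne_zero.mpr h₂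
    simp [*]
  have hdet : (A * B - B * D).det ^ 2 = 64 * a ^ 6 * B.det ^ 2 := by
    rw [hdetB, hA, hB, hD, hd, hg, hf, det_fin_three]
    simp
    ring
  have h := det_fromBlocks_mul_det_sq A B D hne.isUnit
  rw [← hC, hdet, Fintype.card_fin] at h
  refine mul_right_cancel₀ (pow_ne_zero 2 hne) ?_
  linear_combination h
end

section
/- Let A, B, D be the 3×3 matrices A = [[a, a-2, a-2], [-2a+1, d, -2a+1], [f, f, g]], B = [[a-2, -a+2, -a+2], [2a-1, -2a+1, 2a-1], [-f, -f, f]], D = [[-a+3, 3a-3, -a-1], [-a+2, 3a-2, -3a], [3, 2a-1, -2a-1]] with parameters d = 1 - a + i·a·√3, g = -1 - i·a·√3, a ∉ {-1, 0, 2, 1/2}, f ≠ 0, and let C be the unique matrix with A²B - BCB - ABD + BD² = 0. Then C also satisfies CA² - DCA - CBC + D²C = 0, and the block matrices S1 = [[A,B],[C,D]], S2 = [[A,-B],[-C,D]] define a 6-dimensional representation of B₃. -/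
open Matrix Complex

/-- The single braid relation of `B₃`. -/
def braidRel : Set (FreeGroup (Fin 2)) :=
  {FreeGroup.of 0 * FreeGroup.of 1 * FreeGroup.of 0 *
    (FreeGroup.of 1 * FreeGroup.of 0 * FreeGroup.of 1)⁻¹}

/-- The braid group on three strands. -/
abbrev B3 : Type := PresentedGroup braidRel

/-- The generators of `B₃`. -/
def b3σ (i : Fin 2) : B3 := PresentedGroup.of i

/-- Two elements of a group satisfying the braid relation define a homomorphism from `B₃`. -/
theorem exists_b3_hom {H : Type*} [Group H] {x y : H} (h : x * y * x = y * x * y) :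
    ∃ φ : B3 →* H, φ (b3σ 0) = x ∧ φ (b3σ 1) = y := by
  have hrel : ∀ r ∈ braidRel, FreeGroup.lift ![x, y] r = 1 := by
    rintro r rfl
    simp only [map_mul, map_inv, FreeGroup.lift_apply_of, mul_inv_eq_one]
    exact h
  exact ⟨PresentedGroup.toGroup hrel, PresentedGroup.toGroup.of hrel,
    PresentedGroup.toGroup.of hrel⟩

section BlockIdentities

variable {R : Type*} [Ring R] {A B B' C D G c : R}

/-- If `B` is invertible and `G = A - B D B⁻¹`, then the equation
`A² B - B C B - A B D + B D² = 0` determines `C` in terms of `A`, `B` and `G`. -/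
theorem eq_of_braid_block (hB : B' * B = 1) (hBB : B * B' = 1)
    (hG : G * B = A * B - B * D)
    (hC : C = B' * (A ^ 2 * B - A * B * D + B * D ^ 2) * B') :
    D = B' * ((A - G) * B) ∧ C = B' * (A * A - G * A + G * G) := by
  have hBD : B * D = (A - G) * B := by rw [sub_mul, hG, sub_sub_cancel]
  have hD : D = B' * ((A - G) * B) := by rw [← hBD, ← mul_assoc, hB, one_mul]
  refine ⟨hD, ?_⟩
  have hN : A ^ 2 * B - A * B * D + B * D ^ 2 = (A * A - G * A + G * G) * B := by
    rw [pow_two D, ← mul_assoc, hBD, mul_assoc A B D, mul_assoc _ B D, hBD]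
    noncomm_ring
  rw [hC, hN, mul_assoc, mul_assoc, hBB, mul_one]

/-- The entries of the product `S₁ S₂ S₁` of the block matrices `S₁ = [[A, B], [C, D]]` and
`S₂ = [[A, -B], [-C, D]]` when `(A - B D B⁻¹)³ = c` is central. -/
theorem braid_block_entries (hB : B' * B = 1) (hBB : B * B' = 1)
    (hD : D = B' * ((A - G) * B)) (hC : C = B' * (A * A - G * A + G * G))
    (hG : G * (G * G) = c) (hc : ∀ x, c * x = x * c) :
    (A * A - B * C) * A + (B * D - A * B) * C = -c ∧
    (A * A - B * C) * B + (B * D - A * B) * D = 0 ∧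
    (C * A - D * C) * A + (D * D - C * B) * C = 0 ∧
    (C * A - D * C) * B + (D * D - C * B) * D = c := by
  have hBx (x : R) : B * (B' * x) = x := by rw [← mul_assoc, hBB, one_mul]
  have hBC : B * C = A * A - G * A + G * G := by rw [hC, hBx]
  have hBD : B * D = (A - G) * B := by rw [hD, hBx]
  have hDC : D * C = B' * ((A - G) * (A * A - G * A + G * G)) := by
    rw [hD, mul_assoc, mul_assoc, hBC]
  have hDD : D * D = B' * ((A - G) * (A - G) * B) := by
    conv_lhs => rw [hD, mul_assoc, mul_assoc, hBx]
    simp only [mul_assoc]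
  have hP : A * A - B * C = G * (A - G) := by rw [hBC]; noncomm_ring
  have hQ : B * D - A * B = -(G * B) := by rw [hBD]; noncomm_ring
  have hR : C * A - D * C = B' * (A * (G * A) - A * (G * G) + c) := by
    rw [hDC, hC, ← hG]; noncomm_ring
  have hS : D * D - C * B = -(B' * (A * (G * B))) := by
    rw [hDD, hC]; noncomm_ring
  have hAc : A * (G * (G * G)) = c * A := by rw [hG, hc]
  rw [hP, hQ, hR, hS]
  refine ⟨?_, ?_, ?_, ?_⟩
  · rw [neg_mul, mul_assoc G B C, hBC, ← hG]
    noncomm_ring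
  · rw [neg_mul, mul_assoc G B D, hBD]
    noncomm_ring
  · have : B' * (A * (G * B)) * C = B' * (A * (G * (A * A - G * A + G * G))) := by
      simp only [mul_assoc, hBC]
    rw [neg_mul, this]
    calc _ = B' * (c * A - A * (G * (G * G))) := by noncomm_ring
      _ = 0 := by rw [hAc, sub_self, mul_zero]
  · have : B' * (A * (G * B)) * D = B' * (A * (G * ((A - G) * B))) := by
      simp only [mul_assoc, hBD]
    rw [neg_mul, this]
    calc _ = B' * (c * B) := by noncomm_ring
      _ = c := by rw [hc, ← mul_assoc, hB, one_mul]

end BlockIdentities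

/-- If `S₁ = [[A, B], [C, D]]` with `B` invertible, `(A - B D B⁻¹)³ = r ≠ 0` and
`A² B - B C B - A B D + B D² = 0`, then `S₁` and `S₂ = [[A, -B], [-C, D]]` are invertible
and satisfy the braid relation. -/
theorem braid_fromBlocks {n K : Type*} [Fintype n] [DecidableEq n] [Field K]
    {A B C D G : Matrix n n K} {r : K} (hr : r ≠ 0) (hB : IsUnit B.det)
    (hGB : G * B = A * B - B * D) (hG : G * (G * G) = r • (1 : Matrix n n K))
    (hC : C = B⁻¹ * (A ^ 2 * B - A * B * D + B * D ^ 2) * B⁻¹) :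
    C * A ^ 2 - D * C * A - C * B * C + D ^ 2 * C = 0 ∧
    IsUnit (fromBlocks A B C D) ∧ IsUnit (fromBlocks A (-B) (-C) D) ∧
    fromBlocks A B C D * fromBlocks A (-B) (-C) D * fromBlocks A B C D =
      fromBlocks A (-B) (-C) D * fromBlocks A B C D * fromBlocks A (-B) (-C) D := by
  have hBl := nonsing_inv_mul B hB
  have hBr := mul_nonsing_inv B hB
  obtain ⟨hD, hC⟩ := eq_of_braid_block hBl hBr hGB hC
  obtain ⟨h₁₁, h₁₂, h₂₁, h₂₂⟩ := braid_block_entries hBl hBr hD hC hG (by simp)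
  have h₁ : fromBlocks A B C D * fromBlocks A (-B) (-C) D * fromBlocks A B C D =
      fromBlocks (-(r • 1)) 0 0 (r • 1) := by
    rw [fromBlocks_multiply, fromBlocks_multiply, fromBlocks_inj]
    refine ⟨?_, ?_, ?_, ?_⟩
    · rw [← h₁₁]; noncomm_ring
    · rw [← h₁₂]; noncomm_ring
    · rw [← h₂₁]; noncomm_ring
    · rw [← h₂₂]; noncomm_ring
  have h₂ : fromBlocks A (-B) (-C) D * fromBlocks A B C D * fromBlocks A (-B) (-C) D =
      fromBlocks (-(r • 1)) 0 0 (r • 1) := by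
    rw [fromBlocks_multiply, fromBlocks_multiply, fromBlocks_inj]
    refine ⟨?_, ?_, ?_, ?_⟩
    · rw [← h₁₁]; noncomm_ring
    · rw [← neg_eq_zero.2 h₁₂]; noncomm_ring
    · rw [← neg_eq_zero.2 h₂₁]; noncomm_ring
    · rw [← h₂₂]; noncomm_ring
  have hdet : IsUnit ((fromBlocks A B C D).det * (fromBlocks A (-B) (-C) D).det *
      (fromBlocks A B C D).det) := by
    rw [← det_mul, ← det_mul, h₁, det_fromBlocks_zero₂₁]
    simp [det_neg, hr]
  refine ⟨?_, ?_, ?_, h₁.trans h₂.symm⟩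
  · rw [← h₂₁]; noncomm_ring
  · exact (isUnit_iff_isUnit_det _).2 (isUnit_of_mul_isUnit_right hdet)
  · exact (isUnit_iff_isUnit_det _).2
      (isUnit_of_mul_isUnit_right (isUnit_of_mul_isUnit_left hdet))

/-- An upper triangular matrix whose diagonal entries are `2 a` times the three cube roots of
unity has cube `8 a³`. -/
theorem triangular_cube {K : Type*} [Field K] {s : K} (a u v : K) (hs : s ^ 2 = -3) :
    !![2 * a, 0, u; 0, -a + a * s, v; 0, 0, -a - a * s] *
      (!![2 * a, 0, u; 0, -a + a * s, v; 0, 0, -a - a * s] *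
        !![2 * a, 0, u; 0, -a + a * s, v; 0, 0, -a - a * s]) =
      (8 * a ^ 3) • (1 : Matrix (Fin 3) (Fin 3) K) := by
  ext i j
  fin_cases i <;> fin_cases j <;> simp [mul_apply, Fin.sum_univ_three] <;> grind

theorem stmt_17 (a f : ℂ) (ha : a ≠ -1 ∧ a ≠ 0 ∧ a ≠ 2 ∧ a ≠ 1 / 2) (hf : f ≠ 0)
    (d g : ℂ) (hd : d = 1 - a + I * a * (Real.sqrt 3 : ℂ))
    (hg : g = -1 - I * a * (Real.sqrt 3 : ℂ))
    (A B D C : Matrix (Fin 3) (Fin 3) ℂ)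
    (hA : A = !![a, a - 2, a - 2; -2 * a + 1, d, -2 * a + 1; f, f, g])
    (hB : B = !![a - 2, -a + 2, -a + 2; 2 * a - 1, -2 * a + 1, 2 * a - 1; -f, -f, f])
    (hD : D = !![-a + 3, 3 * a - 3, -a - 1; -a + 2, 3 * a - 2, -3 * a; 3, 2 * a - 1, -2 * a - 1])
    (hC : C = B⁻¹ * (A ^ 2 * B - A * B * D + B * D ^ 2) * B⁻¹) :
    C * A ^ 2 - D * C * A - C * B * C + D ^ 2 * C = 0 ∧
    IsUnit (fromBlocks A B C D) ∧ IsUnit (fromBlocks A (-B) (-C) D) ∧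
    fromBlocks A B C D * fromBlocks A (-B) (-C) D * fromBlocks A B C D =
      fromBlocks A (-B) (-C) D * fromBlocks A B C D * fromBlocks A (-B) (-C) D ∧
    ∃ φ : B3 →* GL (Fin 3 ⊕ Fin 3) ℂ,
      (φ (b3σ 0) : Matrix (Fin 3 ⊕ Fin 3) (Fin 3 ⊕ Fin 3) ℂ) = fromBlocks A B C D ∧
      (φ (b3σ 1) : Matrix (Fin 3 ⊕ Fin 3) (Fin 3 ⊕ Fin 3) ℂ) = fromBlocks A (-B) (-C) D := by
  obtain ⟨-, ha₀, ha₂, ha₁⟩ := ha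
  have ha₁' : 2 * a - 1 ≠ 0 := fun h => ha₁ (by linear_combination h / 2)
  have ha₂' : a - 2 ≠ 0 := sub_ne_zero.2 ha₂
  have hs : (I * (Real.sqrt 3 : ℂ)) ^ 2 = -3 := by
    rw [mul_pow, I_sq, ← ofReal_pow, Real.sq_sqrt (by norm_num)]
    norm_num
  set s := I * (Real.sqrt 3 : ℂ)
  have hd' : d = 1 - a + a * s := by rw [hd]; ring
  have hg' : g = -1 - a * s := by rw [hg]; ring
  have hdet : B.det = 4 * (a - 2) * (2 * a - 1) * f := by
    rw [hB, det_fin_three]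
    simp
    ring
  have hGB : !![2 * a, 0, (a - 2) * (f - a - 1) / f;
      0, -a + a * s, -(2 * a - 1) * (f - a - 1) / f; 0, 0, -a - a * s] * B =
      A * B - B * D := by
    rw [hA, hB, hD, hd', hg']
    ext i j
    fin_cases i <;> fin_cases j <;> simp [mul_apply, Fin.sum_univ_three] <;> field_simp <;> ring
  have hBu : IsUnit B.det := by
    rw [hdet]
    exact IsUnit.mk0 _ (by simp [ha₁', ha₂', hf])
  obtain ⟨hrel, h₁, h₂, hbraid⟩ := braid_fromBlocks (by simp [ha₀]) hBu hGB (triangular_cube a _ _ hs) hC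
  refine ⟨hrel, h₁, h₂, hbraid, ?_⟩
  obtain ⟨φ, hφ₀, hφ₁⟩ := exists_b3_hom (x := h₁.unit) (y := h₂.unit) (Units.ext hbraid)
  exact ⟨φ, congrArg Units.val hφ₀, congrArg Units.val hφ₁⟩
end
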